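/- Let X ⊆ FIN_{A⋆} be an infinite block sequence and let (f_n)_{n∈ℕ} be a sequence of colorings f_n : [X]_A → C into a finite set C. Then there exists an infinite block sequence Y ⊆ [X]_{A⋆} such that for every n there is a finite set F ⊆ Y for which [Y − F]_A is f_n-homogeneous. -/

import Mathlib

namespace Carlson

/-- The domain of a partial function `ℕ →. B`, encoded as `ℕ → Option B`. -/
def dom {B : Type*} (p : ℕ → Option B) : Set ℕ := {n | p n ≠ none}

/-- `p` is a located word over `B`: a partial function with finite nonempty domain. -/
def IsLW {B : Type*} (p : ℕ → Option B) : Prop := (dom p).Finite ∧ (dom p).Nonempty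

/-- A located variable word over `A` is a located word over `Option A`
(where `none` encodes the variable `⋆`) taking the value `⋆` at least once. -/
def IsLVW {A : Type*} (p : ℕ → Option (Option A)) : Prop :=
  IsLW p ∧ ∃ n, p n = some none

/-- `p < q`: every element of the domain of `p` is below every element of the domain of `q`. -/
def blt {B : Type*} (p q : ℕ → Option B) : Prop :=
  ∀ m ∈ dom p, ∀ n ∈ dom q, m < n

/-- Union `p ∪ q` of two partial functions (`p` takes precedence; for `blt p q`
the domains are disjoint, so this is the genuine union). -/
def pun {B : Type*} (p q : ℕ → Option B) : ℕ → Option B :=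
  fun n => (p n).elim (q n) some

/-- The empty partial function. -/
def emptyW {B : Type*} : ℕ → Option B := fun _ => none

/-- `p[a]`: substitution of the letter `a ∈ A` for the variable `⋆` in a located
variable word. -/
def substA {A : Type*} (p : ℕ → Option (Option A)) (a : A) : ℕ → Option A :=
  fun n => (p n).map fun x => x.getD a

/-- `p[a]` for `a ∈ A ∪ {⋆}` (with `none` encoding `⋆`, so `p[⋆] = p`). -/
def substV {A : Type*} (p : ℕ → Option (Option A)) (a : Option A) : ℕ → Option (Option A) :=
  fun n => (p n).map fun x => x.elim a some

/-- Union of a finite family of partial functions with pairwise disjoint domains. -/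
def famUnion {B : Type*} {k : ℕ} (g : Fin k → ℕ → Option B) : ℕ → Option B :=
  fun n => ((List.ofFn fun i => g i n).filterMap id).head?

/-- A block sequence: a set of located variable words totally ordered by `<`. -/
def IsBlockSeq {A : Type*} (X : Set (ℕ → Option (Option A))) : Prop :=
  (∀ p ∈ X, IsLVW p) ∧ ∀ p ∈ X, ∀ q ∈ X, p = q ∨ blt p q ∨ blt q p

/-- `[X]_A`: located words of the form `p₀[a₀] ∪ ⋯ ∪ p_k[a_k]` with `p₀ < ⋯ < p_k`
all in `X` and `a₀, …, a_k ∈ A`. -/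
def combA {A : Type*} (X : Set (ℕ → Option (Option A))) : Set (ℕ → Option A) :=
  { q | ∃ (k : ℕ) (p : Fin (k + 1) → ℕ → Option (Option A)) (a : Fin (k + 1) → A),
      (∀ i, p i ∈ X) ∧ (∀ i j : Fin (k + 1), i < j → blt (p i) (p j)) ∧
      q = famUnion fun i => substA (p i) (a i) }

/-- `[X]_{A⋆}`: located variable words of the form `p₀[a₀] ∪ ⋯ ∪ p_k[a_k]` with
`p₀ < ⋯ < p_k` all in `X`, `a₀, …, a_k ∈ A ∪ {⋆}`, and `⋆` used at least once. -/
def combV {A : Type*} (X : Set (ℕ → Option (Option A))) : Set (ℕ → Option (Option A)) :=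
  { q | ∃ (k : ℕ) (p : Fin (k + 1) → ℕ → Option (Option A)) (a : Fin (k + 1) → Option A),
      (∀ i, p i ∈ X) ∧ (∀ i j : Fin (k + 1), i < j → blt (p i) (p j)) ∧
      (∃ i, a i = none) ∧ q = famUnion fun i => substV (p i) (a i) }

/-- `X − F`: the elements of `X` whose domain lies entirely above the domains of
all members of `F`. -/
def sminus {B : Type*} (X F : Set (ℕ → Option B)) : Set (ℕ → Option B) :=
  { q ∈ X | ∀ p ∈ F, blt p q }

/-- `dom q ⊆ [0, ℓ)`. -/
def domBelow {B : Type*} (q : ℕ → Option B) (ℓ : ℕ) : Prop := ∀ n ∈ dom q, n < ℓ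

/-- `dom q ⊆ [m, ∞)`. -/
def domAbove {B : Type*} (q : ℕ → Option B) (m : ℕ) : Prop := ∀ n ∈ dom q, m ≤ n

/-- `S^ℓ_p(f) = S^ℓ_{p'}(g)` for colorings of located words: agreement at `q ∪ p`
vs `q ∪ p'` for every located word `q` with domain contained in `[0, ℓ)`.
(Take `p' = emptyW` to express `S^ℓ_p(f) = S^ℓ(g)`.) -/
def SEq {A C : Type*} (f g : (ℕ → Option A) → C) (ℓ : ℕ) (p p' : ℕ → Option A) : Prop :=
  ∀ q : ℕ → Option A, IsLW q → domBelow q ℓ → f (pun q p) = g (pun q p')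

/-- Variant of `SEq` for colorings that are also defined at the empty located word,
i.e. `q` ranges over `FIN_A(0, ℓ) ∪ {∅}`. -/
def SEq0 {A C : Type*} (f g : (ℕ → Option A) → C) (ℓ : ℕ) (p p' : ℕ → Option A) : Prop :=
  ∀ q : ℕ → Option A, (dom q).Finite → domBelow q ℓ → f (pun q p) = g (pun q p')

/-- A coloring `f` is recurrent if for every `ℓ` there is a located variable word `p`
with domain in `[ℓ, ∞)` such that `S^ℓ_{p[a]}(f) = S^ℓ(f)` for every `a ∈ A`. -/
def Recurrent {A C : Type*} (f : (ℕ → Option A) → C) : Prop :=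
  ∀ ℓ : ℕ, ∃ p : ℕ → Option (Option A), IsLVW p ∧ domAbove p ℓ ∧
    ∀ a : A, SEq f f ℓ (substA p a) emptyW

/-- A coloring `f` is uniformly recurrent if for every `ℓ` there is `m > ℓ` such that
for every `p ∈ FIN_A(m, ∞)` there is `q ∈ FIN_A(ℓ, m)` with `S^ℓ_{q ∪ p}(f) = S^ℓ(f)`. -/
def UnifRecurrent {A C : Type*} (f : (ℕ → Option A) → C) : Prop :=
  ∀ ℓ : ℕ, ∃ m : ℕ, ℓ < m ∧ ∀ p : ℕ → Option A, IsLW p → domAbove p m →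
    ∃ q : ℕ → Option A, IsLW q ∧ domAbove q ℓ ∧ domBelow q m ∧
      SEq f f ℓ (pun q p) emptyW

/-- `f` and `g` are weakly proximal: for every `ℓ` there is `p ∈ FIN_A(ℓ, ∞)` with
`S^ℓ_p(f) = S^ℓ_p(g)`. -/
def WeakProx {A C : Type*} (f g : (ℕ → Option A) → C) : Prop :=
  ∀ ℓ : ℕ, ∃ p : ℕ → Option A, IsLW p ∧ domAbove p ℓ ∧ SEq f g ℓ p p

/-- `g` is strongly proximal to `f`: for every `ℓ` there is a located variable word `p`
with domain in `[ℓ, ∞)` such that `S^ℓ(g) = S^ℓ_{p[a]}(g) = S^ℓ_{p[a]}(f)` for all `a ∈ A`. -/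
def StrongProx {A C : Type*} (g f : (ℕ → Option A) → C) : Prop :=
  ∀ ℓ : ℕ, ∃ p : ℕ → Option (Option A), IsLVW p ∧ domAbove p ℓ ∧
    ∀ a : A, SEq g g ℓ emptyW (substA p a) ∧ SEq g f ℓ (substA p a) (substA p a)

/-- `Recurrent` for colorings also defined at the empty located word. -/
def Recurrent0 {A C : Type*} (f : (ℕ → Option A) → C) : Prop :=
  ∀ ℓ : ℕ, ∃ p : ℕ → Option (Option A), IsLVW p ∧ domAbove p ℓ ∧
    ∀ a : A, SEq0 f f ℓ (substA p a) emptyW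

/-- `StrongProx` for colorings also defined at the empty located word. -/
def StrongProx0 {A C : Type*} (g f : (ℕ → Option A) → C) : Prop :=
  ∀ ℓ : ℕ, ∃ p : ℕ → Option (Option A), IsLVW p ∧ domAbove p ℓ ∧
    ∀ a : A, SEq0 g g ℓ emptyW (substA p a) ∧ SEq0 g f ℓ (substA p a) (substA p a)

/-- Agreement of two colorings on all located words with domain in `[0, ℓ)`. -/
def AgreeBelow {A C : Type*} (f g : (ℕ → Option A) → C) (ℓ : ℕ) : Prop :=
  ∀ q : ℕ → Option A, IsLW q → domBelow q ℓ → f q = g q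

/-- Closedness of a class in `C^{FIN_A}` with the product topology (`C` discrete):
a class is closed iff it contains every coloring all of whose finite restrictions
(to located words with domain in `[0, ℓ)`, for each `ℓ`) are matched within the class. -/
def IsClosedColl {A C : Type*} (𝓒 : Set ((ℕ → Option A) → C)) : Prop :=
  ∀ f, (∀ ℓ : ℕ, ∃ g ∈ 𝓒, AgreeBelow f g ℓ) → f ∈ 𝓒

/-- A subshift: a nonempty closed class `𝓒 ⊆ C^{FIN_A}` such that for every `f ∈ 𝓒`,
`ℓ ∈ ℕ` and `p ∈ FIN_A(ℓ, ∞)` there is `g ∈ 𝓒` with `S^ℓ(g) = S^ℓ_p(f)`. -/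
def IsSubshift {A C : Type*} (𝓒 : Set ((ℕ → Option A) → C)) : Prop :=
  𝓒.Nonempty ∧ IsClosedColl 𝓒 ∧
    ∀ f ∈ 𝓒, ∀ ℓ : ℕ, ∀ p : ℕ → Option A, IsLW p → domAbove p ℓ →
      ∃ g ∈ 𝓒, SEq g f ℓ emptyW p

/-- A minimal subshift: no subshift is a proper subset of it. -/
def IsMinimalSubshift {A C : Type*} (𝓒 : Set ((ℕ → Option A) → C)) : Prop :=
  IsSubshift 𝓒 ∧ ∀ 𝓓 : Set ((ℕ → Option A) → C), IsSubshift 𝓓 → 𝓓 ⊆ 𝓒 → 𝓓 = 𝓒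

/-- The orbit closure of a coloring `f`: all `g` such that for every `ℓ` and every
`q ∈ FIN_A(ℓ, ∞)` there is `p ∈ FIN_A(ℓ, ∞)` with `S^ℓ_q(g) = S^ℓ_p(f)`. -/
def orbCl {A C : Type*} (f : (ℕ → Option A) → C) : Set ((ℕ → Option A) → C) :=
  { g | ∀ ℓ : ℕ, ∀ q : ℕ → Option A, IsLW q → domAbove q ℓ →
      ∃ p : ℕ → Option A, IsLW p ∧ domAbove p ℓ ∧ SEq g f ℓ q p }

/-- A variable word over `A`, encoded as a list over `Option A` with `none` = `⋆`:
the variable must occur at least once. -/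
def IsVarWord {A : Type*} (w : List (Option A)) : Prop := none ∈ w

/-- `w[a]`: replace every occurrence of the variable `⋆` by the letter `a`. -/
def substW {A : Type*} (w : List (Option A)) (a : A) : List A :=
  w.map fun x => x.getD a

/-- `⟨(w_n)_{n∈ℕ}⟩_A`: the words `w_{j₀}[a₀] ⋯ w_{j_{k-1}}[a_{k-1}]` extracted from
the sequence `(w_n)`, for `j₀ < ⋯ < j_{k-1}` and letters `a₀, …, a_{k-1} ∈ A`. -/
def extracted {A : Type*} (w : ℕ → List (Option A)) : Set (List A) :=
  { u | ∃ (k : ℕ) (j : Fin (k + 1) → ℕ) (a : Fin (k + 1) → A),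
      StrictMono j ∧ u = (List.ofFn fun i => substW (w (j i)) (a i)).flatten }

section Ultrafilters

open Filter Topology

/-- A compact right topological semigroup contains an idempotent that is minimal for the order
`e ≤ u ↔ e = e * u = u * e` on idempotents. -/
theorem exists_minimal_idempotent {M : Type*} [Semigroup M] [TopologicalSpace M] [T2Space M]
    (hc : ∀ r : M, Continuous (· * r)) (T : Set M) (hne : T.Nonempty) (hT : IsCompact T)
    (hmul : ∀ᵉ (x ∈ T) (y ∈ T), x * y ∈ T) :
    ∃ u ∈ T, u * u = u ∧ ∀ e ∈ T, e * e = e → e * u = e → u * e = e → e = u := by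
  let S : Set (Set M) :=
    {L | IsClosed L ∧ L.Nonempty ∧ L ⊆ T ∧ ∀ᵉ (x ∈ T) (y ∈ L), x * y ∈ L}
  obtain ⟨L, -, hL⟩ : ∃ L, L ⊆ T ∧ Minimal (· ∈ S) L := by
    refine zorn_superset_nonempty S ?_ T ⟨hT.isClosed, hne, subset_rfl, hmul⟩
    intro c hcS hchain hcne
    have : Nonempty c := hcne.to_subtype
    refine ⟨⋂₀ c, ⟨isClosed_sInter fun s hs => (hcS hs).1, ?_, ?_, ?_⟩,
      fun s hs => Set.sInter_subset_of_mem hs⟩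
    · exact IsCompact.nonempty_sInter_of_directed_nonempty_isCompact_isClosed
        (IsChain.directedOn hchain.symm) (fun s hs => (hcS hs).2.1)
        (fun s hs => hT.of_isClosed_subset (hcS hs).1 (hcS hs).2.2.1) (fun s hs => (hcS hs).1)
    · obtain ⟨s, hs⟩ := hcne
      exact (Set.sInter_subset_of_mem hs).trans (hcS hs).2.2.1
    · exact fun x hx y hy s hs => (hcS hs).2.2.2 x hx y (hy s hs)
  obtain ⟨hLc, hLne, hLT, hLmul⟩ := hL.prop
  obtain ⟨u, huL, huu⟩ := exists_idempotent_in_compact_subsemigroup hc L hLne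
    (hT.of_isClosed_subset hLc hLT) fun x hx y hy => hLmul x (hLT hx) y hy
  refine ⟨u, hLT huL, huu, fun e he hee heu hue => ?_⟩
  have heL : e ∈ L := heu ▸ hLmul e he u huL
  have hS : (· * e) '' T ∈ S := by
    refine ⟨(hT.image (hc e)).isClosed, hne.image _, ?_, ?_⟩
    · rintro _ ⟨t, ht, rfl⟩
      exact hmul t ht e he
    · rintro x hx _ ⟨t, ht, rfl⟩
      exact ⟨x * t, hmul x hx t ht, mul_assoc x t e⟩
  have hsub : (· * e) '' T ⊆ L := by
    rintro _ ⟨t, ht, rfl⟩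
    exact hLmul t ht e heL
  obtain ⟨t, -, ht⟩ := hL.le_of_le hS hsub huL
  have ht' : t * e = u := ht
  calc e = u * e := hue.symm
    _ = t * e * e := by rw [ht']
    _ = t * e := by rw [mul_assoc, hee]
    _ = u := ht'

attribute [local instance] Ultrafilter.semigroup

theorem isCompact_ultrafilters_of_forall_mem {M : Type*} {V : ℕ → Set M} :
    IsCompact {u : Ultrafilter M | ∀ n, V n ∈ u} := by
  rw [Set.ofPred_forall]
  exact (isClosed_iInter fun n => ultrafilter_isClosed_basic (V n)).isCompact

theorem nonempty_ultrafilters_of_forall_mem {M : Type*} {V : ℕ → Set M} (hV : Antitone V)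
    (hne : ∀ n, (V n).Nonempty) : {u : Ultrafilter M | ∀ n, V n ∈ u}.Nonempty := by
  rw [Set.ofPred_forall]
  refine IsCompact.nonempty_iInter_of_sequence_nonempty_isCompact_isClosed _
    (fun n u hu => Filter.mem_of_superset hu (hV n.le_succ)) (fun n => ?_)
    (ultrafilter_isClosed_basic (V 0)).isCompact fun n => ultrafilter_isClosed_basic (V n)
  obtain ⟨x, hx⟩ := hne n
  exact ⟨pure x, hx⟩

theorem mul_mem_ultrafilters {M : Type*} [Semigroup M] {U V W : ℕ → Set M}
    (h : ∀ n, ∀ x ∈ U n, ∃ m, ∀ y ∈ V m, x * y ∈ W n) {p q : Ultrafilter M}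
    (hp : ∀ n, U n ∈ p) (hq : ∀ n, V n ∈ q) (n : ℕ) : W n ∈ p * q := by
  refine (Ultrafilter.eventually_mul p q (· ∈ W n)).2 ?_
  filter_upwards [hp n] with x hx
  obtain ⟨m, hm⟩ := h n x hx
  filter_upwards [hq m] with y hy using hm y hy

theorem map_mul_ultrafilter {M : Type*} [Semigroup M] {σ : M → M}
    (hσ : ∀ x y, σ (x * y) = σ x * σ y) (p q : Ultrafilter M) :
    (p * q).map σ = p.map σ * q.map σ := by
  refine Ultrafilter.coe_inj.mp (Filter.ext' fun P => ?_)
  simp [Ultrafilter.eventually_mul, hσ]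

/-- Given a semigroup `M` with filtrations `W` (constant words) and `V` (variable words) and
substitution endomorphisms `σ a` that fix `W 0` and map `V` into `W`, there are an idempotent
ultrafilter concentrating on `W` and an ultrafilter concentrating on `V` which every `σ a` maps
to it. -/
theorem exists_ultrafilter_map_eq {M A : Type*} [Semigroup M] {W V : ℕ → Set M}
    (hW : Antitone W) (hV : Antitone V) (hWne : ∀ n, (W n).Nonempty) (hVne : ∀ n, (V n).Nonempty)
    (hWW : ∀ n, ∀ x ∈ W n, ∃ m, ∀ y ∈ W m, x * y ∈ W n)
    (hWV : ∀ n, ∀ x ∈ W n, ∃ m, ∀ y ∈ V m, x * y ∈ V n)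
    (hVW : ∀ n, ∀ x ∈ V n, ∃ m, ∀ y ∈ W m, x * y ∈ V n)
    (hVV : ∀ n, ∀ x ∈ V n, ∃ m, ∀ y ∈ V m, x * y ∈ V n)
    (σ : A → M → M) (hσ : ∀ a x y, σ a (x * y) = σ a x * σ a y)
    (hσV : ∀ a n, ∀ x ∈ V n, σ a x ∈ W n) (hσW : ∀ a, ∀ x ∈ W 0, σ a x = x) :
    ∃ u v : Ultrafilter M, u * u = u ∧ (∀ n, V n ∈ v) ∧ ∀ a, v.map (σ a) = u := by
  obtain ⟨u, huW, huu, hmin⟩ := exists_minimal_idempotent Ultrafilter.continuous_mul_left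
    {u : Ultrafilter M | ∀ n, W n ∈ u} (nonempty_ultrafilters_of_forall_mem hW hWne)
    isCompact_ultrafilters_of_forall_mem fun p hp q hq => mul_mem_ultrafilters hWW hp hq
  replace huW : ∀ n, W n ∈ u := huW
  obtain ⟨w, ⟨t, ht, htw⟩, hw⟩ := exists_idempotent_in_compact_subsemigroup
    Ultrafilter.continuous_mul_left ((· * u) '' {v : Ultrafilter M | ∀ n, V n ∈ v})
    ((nonempty_ultrafilters_of_forall_mem hV hVne).image _)
    (isCompact_ultrafilters_of_forall_mem.image (Ultrafilter.continuous_mul_left u)) (by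
      rintro _ ⟨p, hp, rfl⟩ _ ⟨q, hq, rfl⟩
      refine ⟨p * u * q, mul_mem_ultrafilters hVV (mul_mem_ultrafilters hVW hp huW) hq, ?_⟩
      simp only [mul_assoc])
  replace ht : ∀ n, V n ∈ t := ht
  replace htw : t * u = w := htw
  have hwu : w * u = w := by rw [← htw, mul_assoc, huu]
  have hwV : ∀ n, V n ∈ w := htw ▸ mul_mem_ultrafilters hVW ht huW
  have huwV : ∀ n, V n ∈ u * w := mul_mem_ultrafilters hWV huW hwV
  refine ⟨u, u * w, huu, huwV, fun a => ?_⟩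
  have hσu : u.map (σ a) = u := by
    refine Ultrafilter.coe_inj.mp ?_
    rw [Ultrafilter.coe_map]
    exact (Filter.map_congr (Filter.eventually_of_mem (huW 0) (hσW a))).trans Filter.map_id
  refine hmin _ (fun n => Ultrafilter.mem_map.2 (Filter.mem_of_superset (huwV n) (hσV a n))) ?_ ?_ ?_
  · rw [← map_mul_ultrafilter (hσ a), mul_assoc, ← mul_assoc w, hwu, hw]
  · conv_lhs => rw [← hσu]
    rw [← map_mul_ultrafilter (hσ a), hσu, mul_assoc, hwu]
  · conv_lhs => rw [← hσu]
    rw [← map_mul_ultrafilter (hσ a), hσu, ← mul_assoc, huu]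

/-- The fusion argument: `σ a (y n) ∈ E n` together with `σ a (y n) * w ∈ E n` for `w ∈ E (n + 1)`
put all products `σ a₀ (y m₀) * ⋯ * σ aₖ (y mₖ)` with `n ≤ m₀ < ⋯ < mₖ` into `B n`. -/
theorem exists_fusion {M A : Type*} [Finite A] [Semigroup M] {V : ℕ → Set M} {σ : A → M → M}
    {u v : Ultrafilter M} (huu : u * u = u) (hv : ∀ n, V n ∈ v) (hσ : ∀ a, v.map (σ a) = u)
    (g : M → ℕ) {B : ℕ → Set M} (hB : ∀ n, B n ∈ u) :
    ∃ (y : ℕ → M) (E : ℕ → Set M), Antitone E ∧ (∀ n, E n ⊆ B n) ∧ (∀ n, y n ∈ V 0) ∧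
      (∀ n, y (n + 1) ∈ V (g (y n))) ∧
      ∀ n a, σ a (y n) ∈ E n ∧ ∀ w ∈ E (n + 1), σ a (y n) * w ∈ E n := by
  have step : ∀ E ∈ u, ∀ n, ∃ y ∈ V 0 ∩ V n, ∀ a, σ a y ∈ E ∧ ∀ᶠ w in u, σ a y * w ∈ E := by
    intro E hE n
    have hE' : ∀ᶠ x in u, ∀ᶠ w in u, x * w ∈ E := by
      rw [← Ultrafilter.eventually_mul u u (· ∈ E), huu]
      exact hE
    have h : ∀ᶠ y in v, ∀ a, σ a y ∈ E ∧ ∀ᶠ w in u, σ a y * w ∈ E := by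
      refine eventually_all.2 fun a => ?_
      have := Filter.Eventually.and (f := (u : Filter M)) (p := (· ∈ E)) hE hE'
      rw [← hσ a, Ultrafilter.coe_map, eventually_map] at this
      rwa [← Ultrafilter.coe_map, hσ a] at this
    obtain ⟨y, hy, hy'⟩ :=
      (h.and (Filter.inter_mem (hv 0) (hv n) : ∀ᶠ y in v, y ∈ V 0 ∩ V n)).exists
    exact ⟨y, hy', hy⟩
  have : Nonempty M := u.neBot.nonempty
  choose! y hyV hyE using step
  let advance : {E : Set M // E ∈ u} × ℕ → ℕ → {E : Set M // E ∈ u} × ℕ := fun s n =>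
    (⟨s.1 ∩ B (n + 1) ∩ ⋂ a, {w | σ a (y s.1 s.2) * w ∈ s.1.1},
      Filter.inter_mem (Filter.inter_mem s.1.2 (hB _))
        (Filter.iInter_mem.2 fun a => (hyE s.1 s.1.2 s.2 a).2)⟩, g (y s.1 s.2))
  let s : ℕ → {E : Set M // E ∈ u} × ℕ := fun n =>
    Nat.rec (⟨B 0, hB 0⟩, 0) (fun n t => advance t n) n
  refine ⟨fun n => y (s n).1 (s n).2, fun n => (s n).1, antitone_nat_of_succ_le ?_, ?_, ?_, ?_, ?_⟩
  · exact fun n x hx => hx.1.1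
  · rintro (_ | n)
    · exact subset_rfl
    · exact fun x hx => hx.1.2
  · exact fun n => (hyV _ (s n).1.2 _).1
  · exact fun n => (hyV _ (s (n + 1)).1.2 _).2
  · exact fun n a => ⟨(hyE _ (s n).1.2 _ a).1, fun w hw => Set.mem_iInter.1 hw.2 a⟩

theorem exists_color_mem_ultrafilter {M C : Type*} [Finite C] (u : Ultrafilter M) (f : M → C) :
    ∃ c, {x | f x = c} ∈ u := by
  obtain ⟨c, hc⟩ := (u.map f).eq_pure_of_finite
  exact ⟨c, Ultrafilter.mem_map.1 (hc ▸ Ultrafilter.mem_pure.2 rfl : {c} ∈ u.map f)⟩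

end Ultrafilters

section LocatedWords

variable {A B : Type*}

theorem famUnion_zero (g : Fin 1 → ℕ → Option B) : famUnion g = g 0 := by
  funext n
  cases h : g 0 n <;> simp [famUnion, h]

theorem famUnion_succ {k : ℕ} (g : Fin (k + 1) → ℕ → Option B) :
    famUnion g = pun (g 0) (famUnion fun i => g i.succ) := by
  funext n
  cases h : g 0 n <;> simp [famUnion, pun, List.ofFn_succ, h]

theorem dom_pun (p q : ℕ → Option B) : dom (pun p q) = dom p ∪ dom q := by
  ext n
  cases h : p n <;> simp [dom, pun, h]

theorem pun_assoc (p q r : ℕ → Option B) : pun (pun p q) r = pun p (pun q r) := by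
  funext n
  cases h : p n <;> simp [pun, h]

/-- Partial functions form a semigroup under `pun`. -/
abbrev punSemigroup (B : Type*) : Semigroup (ℕ → Option B) where
  mul := pun
  mul_assoc := pun_assoc

theorem dom_substV (p : ℕ → Option (Option A)) (a : Option A) : dom (substV p a) = dom p := by
  ext n
  simp [dom, substV]

theorem substV_none (p : ℕ → Option (Option A)) : substV p none = p := by
  funext n
  rcases h : p n with _ | _ | _ <;> simp [substV, h]

theorem substV_substV_some (p : ℕ → Option (Option A)) (b : Option A) (a : A) :
    substV (substV p b) (some a) = substV p (some (b.getD a)) := by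
  funext n
  rcases h : p n with _ | _ | _ <;> cases b <;> simp [substV, h]

theorem substV_pun (p q : ℕ → Option (Option A)) (a : Option A) :
    substV (pun p q) a = pun (substV p a) (substV q a) := by
  funext n
  rcases h : p n with _ | _ | _ <;> simp [substV, pun, h]

theorem substV_some_ne (p : ℕ → Option (Option A)) (a : A) (n : ℕ) :
    substV p (some a) n ≠ some none := by
  rcases h : p n with _ | _ | _ <;> simp [substV, h]

theorem substV_eq_self {p : ℕ → Option (Option A)} (hp : ∀ n, p n ≠ some none) (a : Option A) :
    substV p a = p := by
  funext n
  rcases h : p n with _ | _ | _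
  · simp [substV, h]
  · exact absurd h (hp n)
  · simp [substV, h]

theorem substA_pun (p q : ℕ → Option (Option A)) (a : A) :
    substA (pun p q) a = pun (substA p a) (substA q a) := by
  funext n
  cases h : p n <;> simp [substA, pun, h]

theorem substA_substV_some (p : ℕ → Option (Option A)) (a b : A) :
    substA (substV p (some a)) b = substA p a := by
  funext n
  rcases h : p n with _ | _ | _ <;> simp [substA, substV, h]

/-- The located (variable) words `p₀[a₀] ∪ ⋯ ∪ p_k[a_k]` with `p₀ < ⋯ < p_k` in `X` and
`aᵢ ∈ A ∪ {⋆}`, where `⋆` need not be used. -/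
inductive Comb (X : Set (ℕ → Option (Option A))) : (ℕ → Option (Option A)) → Prop
  | single {p} (hp : p ∈ X) (a : Option A) : Comb X (substV p a)
  | cons {p w} (hp : p ∈ X) (a : Option A) (hpw : blt p w) (hw : Comb X w) :
      Comb X (pun (substV p a) w)

variable {X : Set (ℕ → Option (Option A))} {w w' : ℕ → Option (Option A)}

theorem Comb.finite_dom (hX : IsBlockSeq X) (hw : Comb X w) : (dom w).Finite := by
  induction hw with
  | single hp a =>
    rw [dom_substV]
    exact (hX.1 _ hp).1.1
  | cons hp a _ _ ih =>
    rw [dom_pun, dom_substV]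
    exact (hX.1 _ hp).1.1.union ih

theorem Comb.pun (hw : Comb X w) (hw' : Comb X w') (h : blt w w') : Comb X (pun w w') := by
  induction hw with
  | single hp a => exact .cons hp a (by rwa [blt, dom_substV] at h) hw'
  | cons hp a hpw _ ih =>
    rw [blt, dom_pun, dom_substV] at h
    rw [pun_assoc]
    refine .cons hp a ?_ (ih fun m hm n hn => h m (.inr hm) n hn)
    intro m hm n hn
    rw [dom_pun] at hn
    exact hn.elim (hpw m hm n) (h m (.inl hm) n)

theorem Comb.substV_some (hw : Comb X w) (a : A) : Comb X (substV w (some a)) := by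
  induction hw with
  | single hp b => exact substV_substV_some _ b a ▸ .single hp _
  | cons hp b hpw _ ih =>
    rw [substV_pun, substV_substV_some]
    exact .cons hp _ (by rwa [blt, dom_substV]) ih

theorem Comb.exists_famUnion (hw : Comb X w) :
    ∃ (k : ℕ) (p : Fin (k + 1) → ℕ → Option (Option A)) (a : Fin (k + 1) → Option A),
      (∀ i, p i ∈ X) ∧ (∀ i j : Fin (k + 1), i < j → blt (p i) (p j)) ∧
      w = famUnion (fun i => substV (p i) (a i)) ∧ (∀ i, dom (p i) ⊆ dom w) ∧
      ∀ n, w n = some none → ∃ i, a i = none := by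
  induction hw with
  | @single p hp a =>
    refine ⟨0, fun _ => p, fun _ => a, fun _ => hp, fun i j hij => ?_, ?_, ?_, ?_⟩
    · exact absurd hij (by lia)
    · rw [famUnion_zero]
    · intro i
      rw [dom_substV]
    · intro n hn
      cases a with
      | none => exact ⟨0, rfl⟩
      | some a => exact absurd hn (substV_some_ne p a n)
  | @cons p w hp a hpw _ ih =>
    obtain ⟨k, q, b, hq, hqq, hw, hdom, hb⟩ := ih
    refine ⟨k + 1, Fin.cons p q, Fin.cons a b, ?_, ?_, ?_, ?_, ?_⟩
    · exact Fin.cases hp hq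
    · intro i j hij
      induction j using Fin.cases with
      | zero => exact absurd hij (Fin.not_lt_zero i)
      | succ j =>
        induction i using Fin.cases with
        | zero => exact fun m hm n hn => hpw m hm n (hdom j hn)
        | succ i => exact hqq i j (Fin.succ_lt_succ_iff.1 hij)
    · rw [famUnion_succ]
      simp [← hw]
    · rw [dom_pun, dom_substV]
      exact Fin.cases Set.subset_union_left fun i => (hdom i).trans Set.subset_union_right
    · intro n hn
      cases a with
      | none => exact ⟨0, rfl⟩
      | some a =>
        obtain ⟨i, hi⟩ := hb n (by
          have := substV_some_ne p a n
          cases h : substV p (some a) n <;> simp_all [Carlson.pun])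
        exact ⟨i.succ, by simpa using hi⟩

theorem Comb.mem_combV (hw : Comb X w) (hstar : ∃ n, w n = some none) : w ∈ combV X := by
  obtain ⟨k, p, a, hp, hlt, hwe, -, ha⟩ := hw.exists_famUnion
  obtain ⟨n, hn⟩ := hstar
  exact ⟨k, p, a, hp, hlt, ha n hn, hwe⟩

theorem IsBlockSeq.exists_domAbove (hX : IsBlockSeq X) (hXinf : X.Infinite) (n : ℕ) :
    ∃ p ∈ X, domAbove p n := by
  by_contra! h
  have h' : ∀ p ∈ X, ∃ k ∈ dom p, k < n := fun p hp => by
    simpa [domAbove] using h p hp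
  choose! t htd htn using h'
  refine hXinf (Set.Finite.of_finite_image ((Set.finite_Iio n).subset ?_) (f := t) ?_)
  · rintro _ ⟨p, hp, rfl⟩
    exact htn p hp
  · intro p hp q hq hpq
    rcases hX.2 p hp q hq with h | h | h
    · exact h
    · exact absurd hpq (h _ (htd p hp) _ (htd q hq)).ne
    · exact absurd hpq (h _ (htd q hq) _ (htd p hp)).ne'

/-- The elements of `[X]_A`, as words over `A ∪ {⋆}`, with domain in `[n, ∞)`. -/
def constAbove (X : Set (ℕ → Option (Option A))) (n : ℕ) : Set (ℕ → Option (Option A)) :=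
  {w | Comb X w ∧ (∀ k, w k ≠ some none) ∧ domAbove w n}

/-- The elements of `[X]_{A⋆}` with domain in `[n, ∞)`. -/
def varAbove (X : Set (ℕ → Option (Option A))) (n : ℕ) : Set (ℕ → Option (Option A)) :=
  {w | Comb X w ∧ (∃ k, w k = some none) ∧ domAbove w n}

theorem constAbove_antitone : Antitone (constAbove X) :=
  fun _ _ h _ hw => ⟨hw.1, hw.2.1, fun k hk => h.trans (hw.2.2 k hk)⟩

theorem varAbove_antitone : Antitone (varAbove X) :=
  fun _ _ h _ hw => ⟨hw.1, hw.2.1, fun k hk => h.trans (hw.2.2 k hk)⟩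

theorem domAbove_pun {p q : ℕ → Option B} {n : ℕ} (hp : domAbove p n) (hq : domAbove q n) :
    domAbove (pun p q) n := by
  intro k hk
  rw [dom_pun] at hk
  exact hk.elim (hp k) (hq k)

theorem substV_mem_constAbove {n : ℕ} (a : A) (hw : w ∈ varAbove X n) :
    substV w (some a) ∈ constAbove X n :=
  ⟨hw.1.substV_some a, substV_some_ne w a, by rw [domAbove, dom_substV]; exact hw.2.2⟩

theorem varAbove_nonempty (hX : IsBlockSeq X) (hXinf : X.Infinite) (n : ℕ) :
    (varAbove X n).Nonempty := by
  obtain ⟨p, hp, hpn⟩ := hX.exists_domAbove hXinf n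
  exact ⟨p, by simpa only [substV_none] using Comb.single hp none, (hX.1 p hp).2, hpn⟩

theorem pun_eq_star_iff (h : blt w w') (k : ℕ) :
    pun w w' k = some none ↔ w k = some none ∨ w' k = some none := by
  have hdisj : w k = none ∨ w' k = none := by
    by_contra! hne
    exact (h k hne.1 k hne.2).false
  rcases hdisj with hk | hk
  · simp [pun, hk]
  · cases hw : w k <;> simp [pun, hk, hw]

/-- A strict upper bound of a finite domain. -/
noncomputable def domBound (p : ℕ → Option B) : ℕ := sSup (dom p) + 1

theorem blt_of_domAbove_domBound {p q : ℕ → Option B} (hp : (dom p).Finite)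
    (hq : domAbove q (domBound p)) : blt p q :=
  fun _ hm n hn => Nat.lt_of_lt_of_le (Nat.lt_succ_of_le (le_csSup hp.bddAbove hm)) (hq n hn)

/-- The joint form of the four closure properties of `constAbove` and `varAbove`. -/
theorem comb_pun_above (hX : IsBlockSeq X) {n : ℕ} (hw : Comb X w) (hwn : domAbove w n)
    (hw' : Comb X w') (hwn' : domAbove w' (max n (domBound w))) :
    Comb X (pun w w') ∧ domAbove (pun w w') n ∧
      ∀ k, pun w w' k = some none ↔ w k = some none ∨ w' k = some none := by
  have hlt : blt w w' := blt_of_domAbove_domBound (hw.finite_dom hX)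
    fun k hk => (le_max_right _ _).trans (hwn' k hk)
  exact ⟨hw.pun hw' hlt, domAbove_pun hwn fun k hk => (le_max_left _ _).trans (hwn' k hk),
    pun_eq_star_iff hlt⟩

theorem exists_famUnion_mem {y : ℕ → ℕ → Option (Option A)}
    {E : ℕ → Set (ℕ → Option (Option A))} (hE : Antitone E)
    (hlt : ∀ i j, i < j → blt (y i) (y j)) (hne : ∀ i, (dom (y i)).Nonempty)
    (hy : ∀ n a, substV (y n) (some a) ∈ E n ∧
      ∀ w ∈ E (n + 1), pun (substV (y n) (some a)) w ∈ E n)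
    (b : A) (k : ℕ) (m : Fin (k + 1) → ℕ) (a : Fin (k + 1) → A)
    (hm : ∀ i j, i < j → blt (y (m i)) (y (m j))) :
    ∃ w ∈ E (m 0), substA w b = famUnion fun i => substA (y (m i)) (a i) := by
  induction k with
  | zero => exact ⟨_, (hy (m 0) (a 0)).1, by rw [famUnion_zero, substA_substV_some]⟩
  | succ k ih =>
    obtain ⟨w, hw, hwe⟩ := ih (fun i => m i.succ) (fun i => a i.succ)
      fun i j hij => hm _ _ (Fin.succ_lt_succ_iff.2 hij)
    have h01 : m 0 < m (Fin.succ 0) := by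
      by_contra! hle
      obtain ⟨s, hs⟩ := hne (m 0)
      obtain ⟨t, ht⟩ := hne (m (Fin.succ 0))
      have h1 := hm 0 (Fin.succ 0) (Fin.succ_pos 0)
      rcases hle.eq_or_lt with heq | hlt'
      · rw [heq] at h1
        exact (h1 s hs s hs).false
      · exact (h1 s hs t ht).asymm (hlt _ _ hlt' t ht s hs)
    exact ⟨_, (hy (m 0) (a 0)).2 w (hE h01 hw),
      by rw [famUnion_succ, substA_pun, substA_substV_some, hwe]⟩

end LocatedWords

/-- Iterated Carlson's theorem for located words: given an infinite block sequence
`X ⊆ FIN_{A⋆}` and countably many colorings `f_n : [X]_A → C`, there is an infinite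
block sequence `Y ⊆ [X]_{A⋆}` such that for every `n` there is a finite `F ⊆ Y` with
`[Y − F]_A` being `f_n`-homogeneous. -/
theorem iterated_carlson_located_words {A C : Type*} [Fintype A] [Nonempty A] [Fintype C]
    (X : Set (ℕ → Option (Option A))) (hX : IsBlockSeq X) (hXinf : X.Infinite)
    (f : ℕ → (ℕ → Option A) → C) :
    ∃ Y : Set (ℕ → Option (Option A)), Y ⊆ combV X ∧ IsBlockSeq Y ∧ Y.Infinite ∧
      ∀ n : ℕ, ∃ F : Set (ℕ → Option (Option A)), F.Finite ∧ F ⊆ Y ∧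
        ∃ c : C, ∀ q ∈ combA (sminus Y F), f n q = c := by
  let _ : Semigroup (ℕ → Option (Option A)) := punSemigroup (Option A)
  let b : A := Classical.arbitrary A
  have hVne := varAbove_nonempty hX hXinf
  obtain ⟨u, v, huu, hv, hσ⟩ := exists_ultrafilter_map_eq (W := constAbove X) (V := varAbove X)
    constAbove_antitone varAbove_antitone
    (fun n => (hVne n).imp' (substV · (some b)) fun w hw => substV_mem_constAbove b hw) hVne
    (fun n x hx => ⟨max n (domBound x), fun y hy =>
      have h := comb_pun_above hX hx.1 hx.2.2 hy.1 hy.2.2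
      ⟨h.1, fun k hk => ((h.2.2 k).1 hk).elim (hx.2.1 k) (hy.2.1 k), h.2.1⟩⟩)
    (fun n x hx => ⟨max n (domBound x), fun y hy =>
      have h := comb_pun_above hX hx.1 hx.2.2 hy.1 hy.2.2
      ⟨h.1, hy.2.1.imp fun k hk => (h.2.2 k).2 (.inr hk), h.2.1⟩⟩)
    (fun n x hx => ⟨max n (domBound x), fun y hy =>
      have h := comb_pun_above hX hx.1 hx.2.2 hy.1 hy.2.2
      ⟨h.1, hx.2.1.imp fun k hk => (h.2.2 k).2 (.inl hk), h.2.1⟩⟩)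
    (fun n x hx => ⟨max n (domBound x), fun y hy =>
      have h := comb_pun_above hX hx.1 hx.2.2 hy.1 hy.2.2
      ⟨h.1, hx.2.1.imp fun k hk => (h.2.2 k).2 (.inl hk), h.2.1⟩⟩)
    (fun (a : A) w => substV w (some a)) (fun a x y => substV_pun x y (some a))
    (fun a n x hx => substV_mem_constAbove a hx) (fun a x hx => substV_eq_self hx.2.1 _)
  choose c hc using fun n => exists_color_mem_ultrafilter u fun w => f n (substA w b)
  obtain ⟨y, E, hE, hEB, hy0, hyg, hy⟩ := exists_fusion huu hv hσ
    (fun w => domBound w) hc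
  have hfin : ∀ n, (dom (y n)).Finite := fun n => (hy0 n).1.finite_dom hX
  have hne : ∀ n, (dom (y n)).Nonempty := fun n =>
    (hy0 n).2.1.imp fun k hk => by simp [dom, hk]
  have hlt : ∀ i j, i < j → blt (y i) (y j) := by
    intro i j hij
    have hstep : ∀ n, blt (y n) (y (n + 1)) := fun n =>
      blt_of_domAbove_domBound (hfin n) (hyg n).2.2
    induction j, hij using Nat.le_induction with
    | base => exact hstep i
    | succ j _ ih =>
      intro s hs t ht
      obtain ⟨r, hr⟩ := hne j
      exact (ih s hs r hr).trans (hstep j r hr t ht)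
  have hirr : ∀ i, ¬blt (y i) (y i) := fun i h => by
    obtain ⟨s, hs⟩ := hne i
    exact (h s hs s hs).false
  have hinj : Function.Injective y := Function.Injective.of_lt_imp_ne fun i j hij h =>
    hirr j (h ▸ hlt i j hij)
  refine ⟨Set.range y, ?_, ⟨?_, ?_⟩, Set.infinite_range_of_injective hinj, fun n => ?_⟩
  · rintro _ ⟨n, rfl⟩
    exact (hy0 n).1.mem_combV (hy0 n).2.1
  · rintro _ ⟨n, rfl⟩
    exact ⟨⟨hfin n, hne n⟩, (hy0 n).2.1⟩
  · rintro _ ⟨i, rfl⟩ _ ⟨j, rfl⟩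
    rcases lt_trichotomy i j with h | h | h
    · exact .inr (.inl (hlt i j h))
    · exact .inl (congrArg y h)
    · exact .inr (.inr (hlt j i h))
  · refine ⟨y '' Set.Iio n, (Set.finite_Iio n).image y, Set.image_subset_range _ _, c n, ?_⟩
    rintro _ ⟨k, p, a, hp, hpp, rfl⟩
    choose m hm using fun i => (hp i).1
    obtain rfl : (fun i => y (m i)) = p := funext hm
    have hnm : n ≤ m 0 := by
      by_contra! h
      exact hirr (m 0) ((hp 0).2 _ ⟨m 0, h, rfl⟩)
    obtain ⟨w, hw, hwe⟩ := exists_famUnion_mem hE hlt hne hy b k m a hpp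
    rw [← hwe]
    exact hEB n (hE hnm hw)

end Carlson
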